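/- Let Ω be a bounded domain of double revolution in ℝ^N = ℝ^{m+n}. For every integer k ≥ 0 there exists a constant C_k ≥ 0 such that for all nonnegative φ ∈ H^1_{0,G}(Ω) with ‖∇φ‖_{L²(Ω)} = 1 one has ∫_{Ω̂} φ(s,t)^{2*+2k} s^{(k+1)(m−1)} t^{(k+1)(n−1)} ds dt ≤ C_k, where 2* = 2N/(N−2). -/

import Mathlib

open MeasureTheory Real Set Filter

noncomputable section

abbrev Euc (N : ℕ) := EuclideanSpace ℝ (Fin N)

/-- `s = (x₁² + ⋯ + x_m²)^{1/2}`. -/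
def sVar (m : ℕ) {N : ℕ} (x : Euc N) : ℝ :=
  Real.sqrt (∑ j : Fin N, if (j : ℕ) < m then x j ^ 2 else 0)

/-- `t = (x_{m+1}² + ⋯ + x_N²)^{1/2}`. -/
def tVar (m : ℕ) {N : ℕ} (x : Euc N) : ℝ :=
  Real.sqrt (∑ j : Fin N, if m ≤ (j : ℕ) then x j ^ 2 else 0)

/-- Pragmatic membership in `H¹₀(Ω)` (continuous representative). -/
def MemH10 {N : ℕ} (Ω : Set (Euc N)) (u : Euc N → ℝ) : Prop :=
  Continuous u ∧ (∀ x ∈ Ω, DifferentiableAt ℝ u x) ∧ (∀ x ∉ Ω, u x = 0) ∧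
    IntegrableOn (fun x => ‖gradient u x‖ ^ 2) Ω volume ∧
    IntegrableOn (fun x => u x ^ 2) Ω volume

/-- The open cross-section `Ω̂` of a domain of double revolution, as a subset of the
open first quadrant in the `(s,t)` plane. -/
def crossSection (m : ℕ) {N : ℕ} (Ω : Set (Euc N)) : Set (ℝ × ℝ) :=
  { q | 0 < q.1 ∧ 0 < q.2 ∧ ∃ x ∈ Ω, sVar m x = q.1 ∧ tVar m x = q.2 }

lemma radial_lintegral {d : ℕ} (hd : 1 ≤ d) : ∃ c : ENNReal, c ≠ 0 ∧ c ≠ ⊤ ∧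
    ∀ f : ℝ → ENNReal, Measurable f →
    ∫⁻ x : EuclideanSpace ℝ (Fin d), f ‖x‖ =
      c * ∫⁻ y in Ioi (0:ℝ), f y * ENNReal.ofReal (y ^ (d - 1)) := by
  have : Nonempty (Fin d) := ⟨⟨0, hd⟩⟩
  let μ : Measure (EuclideanSpace ℝ (Fin d)) := volume
  refine ⟨μ.toSphere univ, ?_, measure_ne_top _ _, fun f hf => ?_⟩
  · have : Nontrivial (EuclideanSpace ℝ (Fin d)) := inferInstance
    simp only [ne_eq, Measure.measure_univ_eq_zero]
    exact Measure.toSphere_ne_zero _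
  calc ∫⁻ x : EuclideanSpace ℝ (Fin d), f ‖x‖
      = ∫⁻ x : ({(0)}ᶜ : Set (EuclideanSpace ℝ (Fin d))), f (‖x.1‖) ∂(μ.comap (↑)) := by
        rw [lintegral_subtype_comap (measurableSet_singleton _).compl fun x ↦ f (‖x‖),
          restrict_compl_singleton]
    _ = ∫⁻ x, f x.2 ∂μ.toSphere.prod (.volumeIoiPow (d - 1)) := by
        have h := μ.measurePreserving_homeomorphUnitSphereProd
        rw [finrank_euclideanSpace_fin] at h
        rw [← h.lintegral_comp (f := fun x => f x.2) (by fun_prop)]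
        simp
    _ = μ.toSphere univ * ∫⁻ y : Ioi (0:ℝ), f y ∂(Measure.volumeIoiPow (d-1)) := by
        rw [lintegral_prod _ (by fun_prop)]
        simp [mul_comm]
    _ = _ := by
        congr 1
        rw [Measure.volumeIoiPow, lintegral_withDensity_eq_lintegral_mul _ (by fun_prop) (by fun_prop)]
        simp only [Pi.mul_apply]
        rw [lintegral_subtype_comap measurableSet_Ioi
          (fun a : ℝ => ENNReal.ofReal (a ^ (d-1)) * f a)]
        simp only [mul_comm]

lemma split_lintegral (m n : ℕ) (f : ℝ × ℝ → ENNReal) (hf : Measurable f) :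
    ∫⁻ x : Euc (m+n), f (sVar m x, tVar m x) =
      ∫⁻ a : Euc m, ∫⁻ b : Euc n, f (‖a‖, ‖b‖) := by
  have h1 := PiLp.volume_preserving_toLp (Fin (m+n))
  have h2 := volume_measurePreserving_piCongrLeft (fun _ : Fin (m+n) => ℝ) (finSumFinEquiv (m := m) (n := n))
  have h3 := volume_measurePreserving_sumPiEquivProdPi_symm (fun _ : Fin m ⊕ Fin n => ℝ)
  have h4 := (PiLp.volume_preserving_ofLp (Fin m)).prod (PiLp.volume_preserving_ofLp (Fin n))
  have h := h1.comp (h2.comp (h3.comp h4))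
  have hs : Measurable (fun x : Euc (m+n) => f (sVar m x, tVar m x)) := by
    unfold sVar tVar
    apply hf.comp
    apply Continuous.measurable
    have : ∀ (p : Fin (m+n) → Prop) [DecidablePred p], Continuous (fun x : Euc (m+n) => ∑ j, if p j then x j ^ 2 else 0) := by
      intro p _
      refine continuous_finsetSum _ fun i _ => ?_
      split_ifs <;> fun_prop
    exact ((this _).sqrt).prodMk ((this _).sqrt)
  rw [← h.lintegral_comp hs]
  rw [lintegral_prod]
  · refine lintegral_congr fun a => lintegral_congr fun b => ?_
    have e1 : ∀ i : Fin m, (MeasurableEquiv.piCongrLeft (fun _ : Fin (m+n) => ℝ) finSumFinEquiv) ((MeasurableEquiv.sumPiEquivProdPi (fun _ : Fin m ⊕ Fin n => ℝ)).symm (a.ofLp, b.ofLp)) (Fin.castAdd n i) = a i := by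
      intro i
      exact Equiv.piCongrLeft_sumInl (fun _ : Fin (m+n) => ℝ) finSumFinEquiv a.ofLp b.ofLp i
    have e2 : ∀ i : Fin n, (MeasurableEquiv.piCongrLeft (fun _ : Fin (m+n) => ℝ) finSumFinEquiv) ((MeasurableEquiv.sumPiEquivProdPi (fun _ : Fin m ⊕ Fin n => ℝ)).symm (a.ofLp, b.ofLp)) (Fin.natAdd m i) = b i := by
      intro i
      exact Equiv.piCongrLeft_sumInr (fun _ : Fin (m+n) => ℝ) finSumFinEquiv a.ofLp b.ofLp i
    congr 2
    · rw [sVar, EuclideanSpace.norm_eq, Fin.sum_univ_add]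
      simp [e1]
    · rw [tVar, EuclideanSpace.norm_eq, Fin.sum_univ_add]
      have : ∀ x : Fin m, ¬ (m ≤ (x : ℕ)) := fun x => by omega
      simp [e2, this]
  · exact (hs.comp h.measurable).aemeasurable

lemma polar (m n : ℕ) (hm : 1 ≤ m) (hn : 1 ≤ n) : ∃ c : ENNReal, c ≠ 0 ∧ c ≠ ⊤ ∧
    ∀ f : ℝ × ℝ → ENNReal, Measurable f →
    ∫⁻ x : Euc (m+n), f (sVar m x, tVar m x) =
      c * ∫⁻ q in (Ioi (0:ℝ)) ×ˢ (Ioi (0:ℝ)), f q * ENNReal.ofReal (q.1 ^ (m-1) * q.2 ^ (n-1)) := by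
  obtain ⟨c, hc0, hct, hc⟩ := radial_lintegral hm
  obtain ⟨d, hd0, hdt, hd⟩ := radial_lintegral hn
  refine ⟨c * d, mul_ne_zero hc0 hd0, ENNReal.mul_ne_top hct hdt, fun f hf => ?_⟩
  rw [split_lintegral m n f hf]
  have : ∀ a : Euc m, ∫⁻ b : Euc n, f (‖a‖, ‖b‖) =
     d * ∫⁻ y in Ioi (0:ℝ), f (‖a‖, y) * ENNReal.ofReal (y ^ (n - 1)) := fun a =>
    hd (fun y => f (‖a‖, y)) (by fun_prop)
  simp_rw [this]
  have hm1 : Measurable fun q : ℝ × ℝ => f q * ENNReal.ofReal (q.2 ^ (n - 1)) := by fun_prop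
  have hm2 : Measurable fun s : ℝ => ∫⁻ y in Ioi (0:ℝ), f (s, y) * ENNReal.ofReal (y ^ (n - 1)) :=
    hm1.lintegral_prod_right'
  rw [hc (fun s => d * ∫⁻ y in Ioi (0:ℝ), f (s, y) * ENNReal.ofReal (y ^ (n - 1))) (hm2.const_mul d)]
  rw [Measure.volume_eq_prod, ← Measure.prod_restrict, lintegral_prod _ (by fun_prop), mul_assoc]
  congr 1
  have hm3 : Measurable fun s : ℝ => ∫⁻ y in Ioi (0:ℝ), f (s, y) * ENNReal.ofReal (s ^ (m-1) * y ^ (n - 1)) :=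
    (by fun_prop : Measurable fun q : ℝ × ℝ => f q * ENNReal.ofReal (q.1 ^ (m-1) * q.2 ^ (n - 1))).lintegral_prod_right'
  rw [← lintegral_const_mul _ hm3]
  refine setLIntegral_congr_fun measurableSet_Ioi fun s hs => ?_
  rw [mul_assoc, ← lintegral_mul_const _ (by fun_prop)]
  congr 1
  refine lintegral_congr fun y => ?_
  rw [ENNReal.ofReal_mul (pow_nonneg (le_of_lt hs) _)]
  ring




lemma line_bound (g : ℝ → ℝ) (O : Set ℝ) (hO : IsOpen O) (hb : BddAbove O) (hg : Continuous g)
    (hd : ∀ x ∈ O, DifferentiableAt ℝ g x) (a : ℝ) (h0 : ∀ x, a ≤ x → x ∉ O → g x = 0) :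
    ENNReal.ofReal (g a) ≤ ∫⁻ y in Ioi a ∩ O, ENNReal.ofReal |deriv g y| := by
  by_cases ha : a ∈ O
  swap
  · simp [h0 a le_rfl ha]
  obtain ⟨M, hM⟩ := hb
  set S : Set ℝ := Ici a ∩ Oᶜ with hS
  have hSc : IsClosed S := isClosed_Ici.inter hO.isClosed_compl
  have haM : a ≤ M := hM ha
  have hSn : S.Nonempty := ⟨M + 1, by simp; linarith, fun h => by have := hM h; linarith⟩
  have hSb : BddBelow S := ⟨a, fun x hx => hx.1⟩
  have hbS : sInf S ∈ S := hSc.csInf_mem hSn hSb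
  set b := sInf S with hbdef
  have hab : a ≤ b := hbS.1
  have hsub : Ioo a b ⊆ Ioi a ∩ O := by
    intro x hx
    refine ⟨hx.1, ?_⟩
    by_contra hxO
    have : b ≤ x := csInf_le hSb ⟨hx.1.le, hxO⟩
    linarith [hx.2]
  refine le_trans ?_ (lintegral_mono_set hsub)
  by_cases htop : ∫⁻ y in Ioo a b, ENNReal.ofReal |deriv g y| = ⊤
  · rw [htop]; exact le_top
  have hint : IntegrableOn (deriv g) (Ioo a b) := by
    refine ⟨(measurable_deriv g).aestronglyMeasurable, ?_⟩
    rw [hasFiniteIntegral_iff_norm]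
    exact lt_top_iff_ne_top.2 htop
  have hint2 : IntervalIntegrable (deriv g) volume a b := by
    rw [intervalIntegrable_iff_integrableOn_Ioo_of_le hab]; exact hint
  have hF := intervalIntegral.integral_eq_sub_of_hasDerivAt_of_le hab hg.continuousOn
    (fun x hx => (hd x (hsub hx).2).hasDerivAt) hint2
  rw [h0 b hab hbS.2] at hF
  have h1 : g a ≤ ∫ y in Ioo a b, |deriv g y| := by
    calc g a = -∫ y in a..b, deriv g y := by rw [hF]; ring
      _ ≤ |∫ y in a..b, deriv g y| := neg_le_abs _
      _ ≤ ∫ y in a..b, |deriv g y| := intervalIntegral.abs_integral_le_integral_abs hab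
      _ = _ := by rw [intervalIntegral.integral_of_le hab, integral_Ioc_eq_integral_Ioo]
  refine (ENNReal.ofReal_le_ofReal h1).trans ?_
  rw [ofReal_integral_eq_lintegral_ofReal hint.abs (Eventually.of_forall fun x => abs_nonneg _)]

lemma line_bound_pow (g : ℝ → ℝ) (O : Set ℝ) (hO : IsOpen O) (hb : BddAbove O) (hg : Continuous g)
    (hd : ∀ x ∈ O, DifferentiableAt ℝ g x) (hnn : ∀ x, 0 ≤ g x)
    (p : ℝ) (hp : 1 ≤ p) (a : ℝ) (h0 : ∀ x, a ≤ x → x ∉ O → g x = 0) :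
    ENNReal.ofReal (g a ^ p) ≤
      ∫⁻ y in Ioi a ∩ O, ENNReal.ofReal (p * g y ^ (p - 1) * |deriv g y|) := by
  have hder : ∀ x ∈ O, HasDerivAt (fun x => g x ^ p) (deriv g x * p * g x ^ (p - 1)) x :=
    fun x hx => (hd x hx).hasDerivAt.rpow_const (Or.inr hp)
  refine (line_bound (fun x => g x ^ p) O hO hb (hg.rpow_const fun x => Or.inr (by linarith))
    (fun x hx => (hder x hx).differentiableAt)
    a (fun x hax hx => by rw [h0 x hax hx, Real.zero_rpow (by linarith)])).trans ?_
  refine setLIntegral_mono' (measurableSet_Ioi.inter hO.measurableSet) fun y hy => ?_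
  rw [(hder y hy.2).deriv, abs_mul, abs_mul, abs_of_nonneg (Real.rpow_nonneg (hnn y) _),
    abs_of_nonneg (by linarith : 0 ≤ p)]
  apply ENNReal.ofReal_le_ofReal
  apply le_of_eq; ring

/-- Cauchy-Schwarz, real form -/
lemma cs_real {α : Type*} [MeasurableSpace α] (μ : Measure α) (f g : α → ℝ)
    (hf : Measurable f) (hg : Measurable g) (hf0 : ∀ x, 0 ≤ f x) (hg0 : ∀ x, 0 ≤ g x) :
    ∫⁻ x, ENNReal.ofReal (f x * g x) ∂μ ≤
      (∫⁻ x, ENNReal.ofReal (f x ^ 2) ∂μ) ^ (1/2 : ℝ) * (∫⁻ x, ENNReal.ofReal (g x ^ 2) ∂μ) ^ (1/2 : ℝ) := by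
  have := ENNReal.lintegral_mul_le_Lp_mul_Lq μ Real.HolderConjugate.two_two
    (f := fun x => ENNReal.ofReal (f x)) (g := fun x => ENNReal.ofReal (g x))
    (by fun_prop) (by fun_prop)
  simp only [Pi.mul_apply, ← ENNReal.ofReal_mul (hf0 _), ENNReal.ofReal_rpow_of_nonneg (hf0 _) zero_le_two,
    ENNReal.ofReal_rpow_of_nonneg (hg0 _) zero_le_two, Real.rpow_two] at this
  exact this

lemma half2d (D : Set (ℝ × ℝ))
    (W : ℝ × ℝ → ℝ) (hW : Continuous W) (hW0 : ∀ q, 0 ≤ W q)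
    (ρ : ℝ × ℝ → ℝ) (hρm : Measurable ρ) (hρ0 : ∀ q, 0 ≤ ρ q)
    (p a : ℝ) (hp : 1 ≤ p) (ha : 1 ≤ a) (E : ENNReal) (G : ℝ × ℝ → ℝ) (hG : Measurable G)
    (hE1 : ∫⁻ q in D, ENNReal.ofReal (|G q| ^ 2 * ρ q) ≤ E) :
    ∫⁻ q in D, ENNReal.ofReal (p * W q ^ (p - 1) * |G q| * ρ q ^ (a / 2)) ≤
      (ENNReal.ofReal (p ^ 2) * ∫⁻ q in D, ENNReal.ofReal (W q ^ (2 * p - 2) * ρ q ^ (a - 1))) ^ (1/2 : ℝ)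
        * E ^ (1/2 : ℝ) := by
  have hp0 : 0 ≤ p := by linarith
  have hWm : Measurable W := hW.measurable
  have h := cs_real (volume.restrict D) (fun q => p * W q ^ (p - 1) * ρ q ^ ((a - 1) / 2))
    (fun q => |G q| * ρ q ^ (1 / 2 : ℝ)) (by fun_prop) (by fun_prop)
    (fun q => mul_nonneg (mul_nonneg hp0 (Real.rpow_nonneg (hW0 q) _)) (Real.rpow_nonneg (hρ0 q) _))
    (fun q => mul_nonneg (abs_nonneg _) (Real.rpow_nonneg (hρ0 q) _))
  have e1 : ∀ q, p * W q ^ (p - 1) * ρ q ^ ((a - 1) / 2) * (|G q| * ρ q ^ (1 / 2 : ℝ)) =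
      p * W q ^ (p - 1) * |G q| * ρ q ^ (a / 2) := by
    intro q
    have : ρ q ^ (a / 2) = ρ q ^ ((a - 1) / 2) * ρ q ^ (1 / 2 : ℝ) := by
      rw [← Real.rpow_add_of_nonneg (hρ0 q) (by linarith) (by norm_num)]
      congr 1; ring
    rw [this]; ring
  have e2 : ∀ q, (p * W q ^ (p - 1) * ρ q ^ ((a - 1) / 2)) ^ 2 =
      p ^ 2 * (W q ^ (2 * p - 2) * ρ q ^ (a - 1)) := by
    intro q
    rw [mul_pow, mul_pow, ← Real.rpow_mul_natCast (hW0 q), ← Real.rpow_mul_natCast (hρ0 q), mul_assoc]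
    congr 3 <;> push_cast <;> ring
  have e3 : ∀ q, (|G q| * ρ q ^ (1 / 2 : ℝ)) ^ 2 = |G q| ^ 2 * ρ q := by
    intro q
    rw [mul_pow, ← Real.rpow_mul_natCast (hρ0 q)]
    norm_num
  simp only [e1, e2, e3] at h
  refine h.trans ?_
  gcongr
  · simp only [ENNReal.ofReal_mul (sq_nonneg p)]
    rw [lintegral_const_mul _ (by fun_prop)]

/-- 2D step. -/
lemma step2d (D : Set (ℝ × ℝ)) (hD : IsOpen D) (hDb : Bornology.IsBounded D)
    (hD0 : ∀ q ∈ D, 0 < q.1 ∧ 0 < q.2)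
    (W : ℝ × ℝ → ℝ) (hW : Continuous W) (hW0 : ∀ q, 0 ≤ W q)
    (hWz : ∀ q, 0 < q.1 → 0 < q.2 → q ∉ D → W q = 0)
    (ρ : ℝ × ℝ → ℝ) (hρm : Measurable ρ) (hρ0 : ∀ q, 0 ≤ ρ q)
    (hρ1 : ∀ s s' t, 0 < s → s ≤ s' → 0 < t → ρ (s,t) ≤ ρ (s',t))
    (hρ2 : ∀ s t t', 0 < s → t ≤ t' → 0 < t → ρ (s,t) ≤ ρ (s,t'))
    (hd1 : ∀ q ∈ D, DifferentiableAt ℝ (fun s => W (s, q.2)) q.1)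
    (hd2 : ∀ q ∈ D, DifferentiableAt ℝ (fun t => W (q.1, t)) q.2)
    (p a : ℝ) (hp : 1 ≤ p) (ha : 1 ≤ a) (E : ENNReal)
    (hE1 : ∫⁻ q in D, ENNReal.ofReal (|deriv (fun s => W (s, q.2)) q.1| ^ 2 * ρ q) ≤ E)
    (hE2 : ∫⁻ q in D, ENNReal.ofReal (|deriv (fun t => W (q.1, t)) q.2| ^ 2 * ρ q) ≤ E) :
    ∫⁻ q in D, ENNReal.ofReal (W q ^ (2 * p) * ρ q ^ a) ≤
      ENNReal.ofReal (p ^ 2) * E * ∫⁻ q in D, ENNReal.ofReal (W q ^ (2 * p - 2) * ρ q ^ (a - 1)) := by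
  have hWm : Measurable W := hW.measurable
  have hp0 : 0 ≤ p := by linarith
  have hG1 : Measurable (fun q : ℝ × ℝ => deriv (fun s => W (s, q.2)) q.1) :=
    (measurable_deriv_with_param (f := fun t s : ℝ => W (s, t)) (by
      simp only [Function.uncurry_def]; fun_prop)).comp measurable_swap
  have hG2 : Measurable (fun q : ℝ × ℝ => deriv (fun t => W (q.1, t)) q.2) :=
    measurable_deriv_with_param (f := fun s t : ℝ => W (s, t)) (by
      simp only [Function.uncurry_def]; fun_prop)
  have H1 := half2d D W hW hW0 ρ hρm hρ0 p a hp ha E _ hG1 hE1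
  have H2 := half2d D W hW hW0 ρ hρm hρ0 p a hp ha E _ hG2 hE2
  set J := ∫⁻ q in D, ENNReal.ofReal (W q ^ (2 * p - 2) * ρ q ^ (a - 1)) with hJ
  set h1 : ℝ × ℝ → ENNReal := fun q => ENNReal.ofReal
    (p * W q ^ (p - 1) * |deriv (fun s => W (s, q.2)) q.1| * ρ q ^ (a / 2)) with hh1
  set h2 : ℝ × ℝ → ENNReal := fun q => ENNReal.ofReal
    (p * W q ^ (p - 1) * |deriv (fun t => W (q.1, t)) q.2| * ρ q ^ (a / 2)) with hh2
  have hh1m : Measurable (D.indicator h1) := Measurable.indicator (by fun_prop) hD.measurableSet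
  have hh2m : Measurable (D.indicator h2) := Measurable.indicator (by fun_prop) hD.measurableSet
  obtain ⟨M, hM⟩ := hDb.exists_norm_le
  -- slices
  have A1 : ∀ q ∈ D, ENNReal.ofReal (W q ^ p * ρ q ^ (a / 2)) ≤ ∫⁻ s, D.indicator h1 (s, q.2) := by
    rintro ⟨s, t⟩ hq
    obtain ⟨hs, ht⟩ := hD0 _ hq
    simp only at hs ht ⊢
    set O : Set ℝ := {y | (y, t) ∈ D} with hO
    have hOo : IsOpen O := hD.preimage (by fun_prop : Continuous fun y : ℝ => (y, t))
    have hOb : BddAbove O := ⟨M, fun y hy => (le_abs_self y).trans ((norm_fst_le (y, t)).trans (hM _ hy))⟩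
    have hl := line_bound_pow (fun y => W (y, t)) O hOo hOb (by fun_prop)
      (fun x hx => hd1 (x, t) hx) (fun x => hW0 _) p hp s
      (fun x hx hxO => hWz (x, t) (lt_of_lt_of_le hs hx) ht hxO)
    rw [ENNReal.ofReal_mul (Real.rpow_nonneg (hW0 _) _)]
    calc _ ≤ (∫⁻ y in Ioi s ∩ O, ENNReal.ofReal (p * W (y, t) ^ (p - 1) *
              |deriv (fun y => W (y, t)) y|)) * ENNReal.ofReal (ρ (s, t) ^ (a / 2)) := by
            gcongr
      _ = ∫⁻ y in Ioi s ∩ O, ENNReal.ofReal (p * W (y, t) ^ (p - 1) *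
              |deriv (fun y => W (y, t)) y|) * ENNReal.ofReal (ρ (s, t) ^ (a / 2)) := by
            rw [lintegral_mul_const' _ _ ENNReal.ofReal_ne_top]
      _ ≤ ∫⁻ y in Ioi s ∩ O, D.indicator h1 (y, t) := by
            refine setLIntegral_mono' (measurableSet_Ioi.inter hOo.measurableSet) fun y hy => ?_
            rw [indicator_of_mem (by exact hy.2)]
            have hc : 0 ≤ p * W (y, t) ^ (p - 1) * |deriv (fun y => W (y, t)) y| :=
              mul_nonneg (mul_nonneg hp0 (Real.rpow_nonneg (hW0 _) _)) (abs_nonneg _)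
            rw [← ENNReal.ofReal_mul hc]
            refine ENNReal.ofReal_le_ofReal (mul_le_mul_of_nonneg_left ?_ hc)
            exact Real.rpow_le_rpow (hρ0 _) (hρ1 _ _ _ hs (le_of_lt hy.1) ht) (by linarith)
      _ ≤ _ := setLIntegral_le_lintegral _ _
  have A2 : ∀ q ∈ D, ENNReal.ofReal (W q ^ p * ρ q ^ (a / 2)) ≤ ∫⁻ t, D.indicator h2 (q.1, t) := by
    rintro ⟨s, t⟩ hq
    obtain ⟨hs, ht⟩ := hD0 _ hq
    simp only at hs ht ⊢
    set O : Set ℝ := {y | (s, y) ∈ D} with hO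
    have hOo : IsOpen O := hD.preimage (by fun_prop : Continuous fun y : ℝ => (s, y))
    have hOb : BddAbove O := ⟨M, fun y hy => (le_abs_self y).trans ((norm_snd_le (s, y)).trans (hM _ hy))⟩
    have hl := line_bound_pow (fun y => W (s, y)) O hOo hOb (by fun_prop)
      (fun x hx => hd2 (s, x) hx) (fun x => hW0 _) p hp t
      (fun x hx hxO => hWz (s, x) hs (lt_of_lt_of_le ht hx) hxO)
    rw [ENNReal.ofReal_mul (Real.rpow_nonneg (hW0 _) _)]
    calc _ ≤ (∫⁻ y in Ioi t ∩ O, ENNReal.ofReal (p * W (s, y) ^ (p - 1) *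
              |deriv (fun y => W (s, y)) y|)) * ENNReal.ofReal (ρ (s, t) ^ (a / 2)) := by
            gcongr
      _ = ∫⁻ y in Ioi t ∩ O, ENNReal.ofReal (p * W (s, y) ^ (p - 1) *
              |deriv (fun y => W (s, y)) y|) * ENNReal.ofReal (ρ (s, t) ^ (a / 2)) := by
            rw [lintegral_mul_const' _ _ ENNReal.ofReal_ne_top]
      _ ≤ ∫⁻ y in Ioi t ∩ O, D.indicator h2 (s, y) := by
            refine setLIntegral_mono' (measurableSet_Ioi.inter hOo.measurableSet) fun y hy => ?_
            rw [indicator_of_mem (by exact hy.2)]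
            have hc : 0 ≤ p * W (s, y) ^ (p - 1) * |deriv (fun y => W (s, y)) y| :=
              mul_nonneg (mul_nonneg hp0 (Real.rpow_nonneg (hW0 _) _)) (abs_nonneg _)
            rw [← ENNReal.ofReal_mul hc]
            refine ENNReal.ofReal_le_ofReal (mul_le_mul_of_nonneg_left ?_ hc)
            exact Real.rpow_le_rpow (hρ0 _) (hρ2 _ _ _ hs (le_of_lt hy.1) ht) (by linarith)
      _ ≤ _ := setLIntegral_le_lintegral _ _
  have hA : Measurable fun t => ∫⁻ s, D.indicator h1 (s, t) := hh1m.lintegral_prod_left'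
  have hB : Measurable fun s => ∫⁻ t, D.indicator h2 (s, t) := hh2m.lintegral_prod_right'
  calc ∫⁻ q in D, ENNReal.ofReal (W q ^ (2 * p) * ρ q ^ a)
      ≤ ∫⁻ q in D, (∫⁻ t, D.indicator h2 (q.1, t)) * (∫⁻ s, D.indicator h1 (s, q.2)) := by
        refine setLIntegral_mono' hD.measurableSet fun q hq => ?_
        have : W q ^ (2 * p) * ρ q ^ a = (W q ^ p * ρ q ^ (a / 2)) * (W q ^ p * ρ q ^ (a / 2)) := by
          rw [← sq, mul_pow, ← Real.rpow_mul_natCast (hW0 q), ← Real.rpow_mul_natCast (hρ0 q)]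
          congr 2 <;> push_cast <;> ring
        rw [this, ENNReal.ofReal_mul (mul_nonneg (Real.rpow_nonneg (hW0 _) _) (Real.rpow_nonneg (hρ0 _) _))]
        exact mul_le_mul' (A2 q hq) (A1 q hq)
    _ ≤ ∫⁻ q : ℝ × ℝ, (∫⁻ t, D.indicator h2 (q.1, t)) * (∫⁻ s, D.indicator h1 (s, q.2)) :=
        setLIntegral_le_lintegral _ _
    _ = (∫⁻ s, ∫⁻ t, D.indicator h2 (s, t)) * (∫⁻ t, ∫⁻ s, D.indicator h1 (s, t)) := by
        rw [Measure.volume_eq_prod, lintegral_prod_mul hB.aemeasurable hA.aemeasurable]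
    _ = (∫⁻ q in D, h2 q) * (∫⁻ q in D, h1 q) := by
        rw [← lintegral_prod _ hh2m.aemeasurable, ← lintegral_prod_symm _ hh1m.aemeasurable,
          ← Measure.volume_eq_prod, lintegral_indicator hD.measurableSet, lintegral_indicator hD.measurableSet]
    _ ≤ ((ENNReal.ofReal (p ^ 2) * J) ^ (1/2 : ℝ) * E ^ (1/2 : ℝ)) *
        ((ENNReal.ofReal (p ^ 2) * J) ^ (1/2 : ℝ) * E ^ (1/2 : ℝ)) := mul_le_mul' H2 H1
    _ = _ := by
        have hx : ∀ x : ENNReal, x ^ (1/2 : ℝ) * x ^ (1/2 : ℝ) = x := fun x => by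
          rw [← ENNReal.rpow_add_of_nonneg _ _ (by norm_num) (by norm_num)]; norm_num
        rw [mul_mul_mul_comm, hx, hx]; ring

lemma absorb (X c : ENNReal) (θ : ℝ) (hθ0 : 0 < θ) (hθ : θ < 1) (hX : X ≠ ⊤)
    (h : X ≤ (c * X) ^ θ) : X ≤ (c ^ θ) ^ (1 - θ)⁻¹ := by
  by_cases hX0 : X = 0
  · simp [hX0]
  rw [ENNReal.mul_rpow_of_nonneg _ _ hθ0.le] at h
  have h1 : X ^ (1 - θ) ≤ c ^ θ := by
    rw [ENNReal.rpow_sub _ _ hX0 hX, ENNReal.rpow_one]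
    exact ENNReal.div_le_of_le_mul h
  calc X = (X ^ (1 - θ)) ^ (1 - θ)⁻¹ := by
        rw [← ENNReal.rpow_mul, mul_inv_cancel₀ (by linarith), ENNReal.rpow_one]
    _ ≤ _ := ENNReal.rpow_le_rpow h1 (by rw [inv_nonneg]; linarith)

lemma sobolev (N : ℕ) (hN : 3 ≤ N) : ∃ K : ENNReal, K ≠ ⊤ ∧
    ∀ (Ω : Set (Euc N)) (φ : Euc N → ℝ), IsOpen Ω → Bornology.IsBounded Ω →
    Continuous φ → (∀ x ∈ Ω, DifferentiableAt ℝ φ x) → (∀ x ∉ Ω, φ x = 0) → (∀ x, 0 ≤ φ x) →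
    (∫⁻ x in Ω, ENNReal.ofReal (‖fderiv ℝ φ x‖ ^ 2)) ≤ 1 →
    ∫⁻ x, ENNReal.ofReal (φ x ^ (2 * (N : ℝ) / ((N : ℝ) - 2))) ≤ K := by
  have hNR : (3 : ℝ) ≤ N := by exact_mod_cast hN
  have hN2 : (0 : ℝ) < N - 2 := by linarith
  have hN1 : (0 : ℝ) < N - 1 := by linarith
  set γ : ℝ := 2 * (N - 1) / (N - 2) with hγ
  set q : ℝ := N / (N - 1) with hq
  set r : ℝ := 2 * (N : ℝ) / ((N : ℝ) - 2) with hr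
  have hγ1 : 1 ≤ γ := by rw [hγ, le_div_iff₀ hN2]; linarith
  have hγ0 : 0 ≤ γ := by linarith
  have hr0 : 0 < r := by positivity
  have hr1 : (γ - 1) * 2 = r := by rw [hγ, hr]; field_simp; ring
  have hr2 : γ * q = r := by rw [hγ, hr, hq]; field_simp
  have hq2 : q / 2 < 1 := by rw [hq, div_div, div_lt_one (by positivity)]; linarith
  have hq0 : 0 < q := by positivity
  refine ⟨((ENNReal.ofReal (γ ^ 2)) ^ (q / 2)) ^ (1 - q / 2)⁻¹, ?_, ?_⟩
  · refine ENNReal.rpow_ne_top_of_nonneg (by rw [inv_nonneg]; linarith)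
      (ENNReal.rpow_ne_top_of_nonneg (by positivity) ENNReal.ofReal_ne_top)
  intro Ω φ hΩ hΩb hφ hd hz hnn hE
  have hφm : Measurable φ := hφ.measurable
  set X := ∫⁻ x, ENNReal.ofReal (φ x ^ r) with hX
  have hXΩ : X = ∫⁻ x in Ω, ENNReal.ofReal (φ x ^ r) := by
    rw [hX, ← lintegral_indicator hΩ.measurableSet]
    refine lintegral_congr fun x => ?_
    by_cases hx : x ∈ Ω
    · rw [indicator_of_mem hx]
    · rw [indicator_of_notMem hx, hz x hx, Real.zero_rpow hr0.ne', ENNReal.ofReal_zero]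
  have hXtop : X ≠ ⊤ := by
    obtain ⟨M, hM⟩ := (hΩb.isCompact_closure).exists_bound_of_continuousOn hφ.continuousOn
    rw [hXΩ]
    refine ne_top_of_le_ne_top (b := ENNReal.ofReal (M ^ r) * volume Ω) ?_ ?_
    · exact ENNReal.mul_ne_top ENNReal.ofReal_ne_top hΩb.measure_lt_top.ne
    · rw [← setLIntegral_const]
      refine setLIntegral_mono' hΩ.measurableSet fun x hx => ENNReal.ofReal_le_ofReal ?_
      exact Real.rpow_le_rpow (hnn x) ((le_abs_self _).trans (hM x (subset_closure hx))) hr0.le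
  apply absorb X _ (q / 2) (by positivity) hq2 hXtop
  set F : Euc N → ENNReal := Ω.indicator fun x =>
    ENNReal.ofReal (γ * φ x ^ (γ - 1) * ‖fderiv ℝ φ x‖) with hF
  have hFm : Measurable F := by
    refine Measurable.indicator ?_ hΩ.measurableSet
    have := (measurable_fderiv ℝ φ).norm
    fun_prop
  have hF1 : ∫⁻ x, F x ≤ (ENNReal.ofReal (γ ^ 2) * X) ^ (1/2 : ℝ) := by
    rw [hF, lintegral_indicator hΩ.measurableSet]
    refine (cs_real (volume.restrict Ω) (fun x => γ * φ x ^ (γ - 1)) (fun x => ‖fderiv ℝ φ x‖)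
      (by fun_prop) (measurable_fderiv ℝ φ).norm
      (fun x => mul_nonneg hγ0 (Real.rpow_nonneg (hnn x) _)) (fun x => norm_nonneg _)).trans ?_
    have e : ∀ x, (γ * φ x ^ (γ - 1)) ^ 2 = γ ^ 2 * φ x ^ r := by
      intro x
      rw [mul_pow, ← Real.rpow_mul_natCast (hnn x)]
      push_cast
      rw [hr1]
    simp only [e, ENNReal.ofReal_mul (sq_nonneg γ)]
    rw [lintegral_const_mul _ (by fun_prop), ← hXΩ]
    calc _ ≤ (ENNReal.ofReal (γ ^ 2) * X) ^ (1/2 : ℝ) * 1 := by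
          gcongr
          calc _ ≤ (1 : ENNReal) ^ (1/2 : ℝ) := ENNReal.rpow_le_rpow hE (by norm_num)
            _ = 1 := by simp
      _ = _ := mul_one _
  have hv := PiLp.volume_preserving_toLp (Fin N)
  have key : ∀ (x : Fin N → ℝ) (i : Fin N), ENNReal.ofReal (φ (WithLp.toLp 2 x) ^ γ) ≤
      ∫⁻ y, F (WithLp.toLp 2 (Function.update x i y)) := by
    intro x i
    set ℓ : ℝ → Euc N := fun y => WithLp.toLp 2 (Function.update x i y) with hℓ
    have hℓd : ∀ y, HasDerivAt ℓ (EuclideanSpace.single i (1:ℝ)) y := by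
      intro y
      have : ℓ = fun y => WithLp.toLp 2 x + (y - x i) • EuclideanSpace.single i (1:ℝ) := by
        funext y
        ext j
        by_cases hj : j = i
        · subst hj; simp [hℓ]
        · simp [hℓ, hj]
      rw [this]
      simpa using (((hasDerivAt_id y).sub_const (x i)).smul_const (EuclideanSpace.single i (1:ℝ))).const_add (WithLp.toLp 2 x)
    have hℓc : Continuous ℓ := continuous_iff_continuousAt.2 fun y => (hℓd y).continuousAt
    obtain ⟨M, hM⟩ := hΩb.exists_norm_le
    set O : Set ℝ := ℓ ⁻¹' Ω with hO
    have hOo : IsOpen O := hΩ.preimage hℓc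
    have hcd : ∀ y ∈ O, HasDerivAt (fun y => φ (ℓ y)) (fderiv ℝ φ (ℓ y) (EuclideanSpace.single i (1:ℝ))) y :=
      fun y hy => (hd _ hy).hasFDerivAt.comp_hasDerivAt y (hℓd y)
    have hb : BddAbove O := by
      refine ⟨M, fun y hy => ?_⟩
      have h1 := PiLp.norm_apply_le (ℓ y) i
      have h2 := hM _ hy
      have h3 : (ℓ y) i = y := by simp [hℓ]
      rw [h3] at h1
      exact (le_abs_self y).trans (h1.trans h2)
    have hl := line_bound_pow (fun y => φ (ℓ y)) O hOo hb (hφ.comp hℓc)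
      (fun y hy => (hcd y hy).differentiableAt) (fun y => hnn _) γ hγ1 (x i)
      (fun y _ hy => hz _ hy)
    have hxi : ℓ (x i) = WithLp.toLp 2 x := by simp [hℓ]
    rw [← hxi]
    refine hl.trans (le_trans ?_ (setLIntegral_le_lintegral (Ioi (x i) ∩ O) _))
    refine setLIntegral_mono' (measurableSet_Ioi.inter hOo.measurableSet) fun y hy => ?_
    change _ ≤ F (ℓ y)
    rw [hF, indicator_of_mem (by exact hy.2)]
    apply ENNReal.ofReal_le_ofReal
    apply mul_le_mul_of_nonneg_left _ (mul_nonneg hγ0 (Real.rpow_nonneg (hnn _) _))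
    rw [(hcd y hy.2).deriv]
    refine ((fderiv ℝ φ (ℓ y)).le_opNorm _).trans ?_
    simp
  have hcard : (Fintype.card (Fin N) : ℝ) = N := by simp
  have hconj : Real.HolderConjugate (Fintype.card (Fin N)) q := by
    rw [hcard, Real.holderConjugate_iff]
    refine ⟨by linarith, ?_⟩
    rw [hq]; field_simp; ring
  have hgrid := lintegral_prod_lintegral_pow_le (fun _ : Fin N => (volume : Measure ℝ)) hconj
    (f := fun x => F (WithLp.toLp 2 x)) (hFm.comp hv.measurable)
  rw [hcard] at hgrid
  calc X = ∫⁻ x : Fin N → ℝ, ENNReal.ofReal (φ (WithLp.toLp 2 x) ^ r) := by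
        rw [hX, ← hv.lintegral_comp (by fun_prop)]
    _ ≤ ∫⁻ x : Fin N → ℝ, ∏ i, (∫⁻ y, F (WithLp.toLp 2 (Function.update x i y))) ^ ((1:ℝ) / (N - 1)) := by
        refine lintegral_mono fun x => ?_
        calc ENNReal.ofReal (φ (WithLp.toLp 2 x) ^ r)
            = ∏ i : Fin N, (ENNReal.ofReal (φ (WithLp.toLp 2 x) ^ γ)) ^ ((1:ℝ) / (N - 1)) := by
              rw [Finset.prod_const, Finset.card_univ, Fintype.card_fin, ← ENNReal.rpow_mul_natCast,
                ENNReal.ofReal_rpow_of_nonneg (Real.rpow_nonneg (hnn _) _) (by positivity),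
                ← Real.rpow_mul (hnn _)]
              congr 2
              rw [← hr2, hq]; ring
          _ ≤ _ := by
              refine Finset.prod_le_prod' fun i _ => ?_
              exact ENNReal.rpow_le_rpow (key x i) (by positivity)
    _ ≤ (∫⁻ x : Fin N → ℝ, F (WithLp.toLp 2 x)) ^ q := hgrid
    _ = (∫⁻ x, F x) ^ q := by rw [← hv.lintegral_comp hFm]
    _ ≤ ((ENNReal.ofReal (γ ^ 2) * X) ^ (1/2 : ℝ)) ^ q := ENNReal.rpow_le_rpow hF1 hq0.le
    _ = _ := by
        rw [← ENNReal.rpow_mul]; congr 1; ring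

lemma rad {N : ℕ} (p p' : Fin N → Prop) [DecidablePred p] [DecidablePred p']
    (hpp : ∀ j, p' j → ¬ p j) (x : Euc N) (S : ℝ)
    (hS : S = Real.sqrt (∑ j, if p j then x j ^ 2 else 0)) (h : 0 < S) :
    ∃ v : Euc N, ‖v‖ ≤ 1 ∧ ∀ y : ℝ,
      Real.sqrt (∑ j, if p j then (x + (y - S) • v) j ^ 2 else 0) = |y| ∧
      (∑ j, if p' j then (x + (y - S) • v) j ^ 2 else 0) = ∑ j, if p' j then x j ^ 2 else 0 := by
  have hsum0 : 0 ≤ ∑ j, if p j then x j ^ 2 else 0 :=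
    Finset.sum_nonneg fun j _ => by split_ifs <;> positivity
  have hS2 : (∑ j, if p j then x j ^ 2 else 0) = S ^ 2 := by
    rw [hS, Real.sq_sqrt hsum0]
  refine ⟨WithLp.toLp 2 (fun j => if p j then x j / S else 0), ?_, fun y => ⟨?_, ?_⟩⟩
  · rw [EuclideanSpace.norm_eq, Real.sqrt_le_one]
    apply le_of_eq
    calc _ = ∑ j, (if p j then x j ^ 2 else 0) / S ^ 2 := by
          refine Finset.sum_congr rfl fun j _ => ?_
          by_cases hj : p j <;> simp [hj, div_pow]
      _ = 1 := by rw [← Finset.sum_div, hS2]; field_simp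
  · have : (∑ j, if p j then (x + (y - S) • WithLp.toLp 2 (fun j => if p j then x j / S else 0) : Euc N) j ^ 2 else 0) = y ^ 2 := by
      calc _ = ∑ j, (y / S) ^ 2 * (if p j then x j ^ 2 else 0) := by
            refine Finset.sum_congr rfl fun j _ => ?_
            by_cases hj : p j
            · simp [hj]; field_simp; ring
            · simp [hj]
        _ = y ^ 2 := by rw [← Finset.mul_sum, hS2]; field_simp
    rw [this, Real.sqrt_sq_eq_abs]
  · refine Finset.sum_congr rfl fun j _ => ?_
    by_cases hj : p' j
    · simp [hj, hpp j hj]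
    · simp [hj]

/-- the section point -/
def PP (m n : ℕ) (hm : 1 ≤ m) (hn : 1 ≤ n) (q : ℝ × ℝ) : Euc (m + n) :=
  q.1 • EuclideanSpace.single (⟨0, by omega⟩ : Fin (m+n)) (1:ℝ) +
    q.2 • EuclideanSpace.single (⟨m, by omega⟩ : Fin (m+n)) (1:ℝ)

lemma PP_cont (m n : ℕ) (hm : 1 ≤ m) (hn : 1 ≤ n) : Continuous (PP m n hm hn) := by
  unfold PP; fun_prop

lemma sVar_PP (m n : ℕ) (hm : 1 ≤ m) (hn : 1 ≤ n) (q : ℝ × ℝ) : sVar m (PP m n hm hn q) = |q.1| := by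
  rw [sVar, Finset.sum_eq_single (⟨0, by omega⟩ : Fin (m+n)), ← Real.sqrt_sq_eq_abs]
  · congr 1
    have : (⟨0, by omega⟩ : Fin (m+n)) ≠ ⟨m, by omega⟩ := by simp; omega
    have hm0 : 0 < m := hm
    simp [PP, hm0, this]
  · intro j _ hj
    split_ifs with h
    · have : j ≠ ⟨m, by omega⟩ := by intro h'; rw [h'] at h; simp at h
      simp [PP, hj, this]
    · rfl
  · simp

lemma tVar_PP (m n : ℕ) (hm : 1 ≤ m) (hn : 1 ≤ n) (q : ℝ × ℝ) : tVar m (PP m n hm hn q) = |q.2| := by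
  rw [tVar, Finset.sum_eq_single (⟨m, by omega⟩ : Fin (m+n)), ← Real.sqrt_sq_eq_abs]
  · congr 1
    have : (⟨m, by omega⟩ : Fin (m+n)) ≠ ⟨0, by omega⟩ := by simp; omega
    simp [PP, this]
  · intro j _ hj
    split_ifs with h
    · have : j ≠ ⟨0, by omega⟩ := by intro h'; rw [h'] at h; simp at h; omega
      simp [PP, hj, this]
    · rfl
  · simp

lemma cross_iff (m n : ℕ) (hm : 1 ≤ m) (hn : 1 ≤ n) (Ω : Set (Euc (m+n)))
    (hΩsym : ∀ x y : Euc (m+n), sVar m x = sVar m y → tVar m x = tVar m y → (x ∈ Ω ↔ y ∈ Ω))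
    (q : ℝ × ℝ) : q ∈ crossSection m Ω ↔ 0 < q.1 ∧ 0 < q.2 ∧ PP m n hm hn q ∈ Ω := by
  constructor
  · rintro ⟨h1, h2, x, hx, hs, ht⟩
    refine ⟨h1, h2, (hΩsym x _ ?_ ?_).1 hx⟩
    · rw [sVar_PP, hs, abs_of_pos h1]
    · rw [tVar_PP, ht, abs_of_pos h2]
  · rintro ⟨h1, h2, h3⟩
    exact ⟨h1, h2, _, h3, by rw [sVar_PP, abs_of_pos h1], by rw [tVar_PP, abs_of_pos h2]⟩

lemma cross_open (m n : ℕ) (hm : 1 ≤ m) (hn : 1 ≤ n) (Ω : Set (Euc (m+n))) (hΩ : IsOpen Ω)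
    (hΩsym : ∀ x y : Euc (m+n), sVar m x = sVar m y → tVar m x = tVar m y → (x ∈ Ω ↔ y ∈ Ω)) :
    IsOpen (crossSection m Ω) := by
  have : crossSection m Ω = {q | 0 < q.1} ∩ ({q | 0 < q.2} ∩ PP m n hm hn ⁻¹' Ω) := by
    ext q; rw [cross_iff m n hm hn Ω hΩsym]; rfl
  rw [this]
  exact (isOpen_lt continuous_const continuous_fst).inter
    ((isOpen_lt continuous_const continuous_snd).inter (hΩ.preimage (PP_cont m n hm hn)))

lemma cross_bdd (m n : ℕ) (hm : 1 ≤ m) (hn : 1 ≤ n) (Ω : Set (Euc (m+n)))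
    (hΩb : Bornology.IsBounded Ω)
    (hΩsym : ∀ x y : Euc (m+n), sVar m x = sVar m y → tVar m x = tVar m y → (x ∈ Ω ↔ y ∈ Ω)) :
    Bornology.IsBounded (crossSection m Ω) := by
  obtain ⟨M, hM⟩ := hΩb.exists_norm_le
  refine isBounded_iff_forall_norm_le.2 ⟨M, fun q hq => ?_⟩
  rw [cross_iff m n hm hn Ω hΩsym] at hq
  have h := hM _ hq.2.2
  have h01 : (⟨0, by omega⟩ : Fin (m+n)) ≠ ⟨m, by omega⟩ := by simp; omega
  have h1 := PiLp.norm_apply_le (PP m n hm hn q) (⟨0, by omega⟩ : Fin (m+n))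
  have h2 := PiLp.norm_apply_le (PP m n hm hn q) (⟨m, by omega⟩ : Fin (m+n))
  have e1 : PP m n hm hn q (⟨0, by omega⟩ : Fin (m+n)) = q.1 := by simp [PP, h01]
  have e2 : PP m n hm hn q (⟨m, by omega⟩ : Fin (m+n)) = q.2 := by simp [PP, h01.symm]
  rw [e1] at h1
  rw [e2] at h2
  rw [Prod.norm_def]
  exact max_le (h1.trans h) (h2.trans h)

/-- weighted bound from polar coordinates -/
lemma polar_bound (m n : ℕ) (c : ENNReal) (hc0 : c ≠ 0) (hct : c ≠ ⊤)
    (hc : ∀ f : ℝ × ℝ → ENNReal, Measurable f →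
    ∫⁻ x : Euc (m+n), f (sVar m x, tVar m x) =
      c * ∫⁻ q in (Ioi (0:ℝ)) ×ˢ (Ioi (0:ℝ)), f q * ENNReal.ofReal (q.1 ^ (m-1) * q.2 ^ (n-1)))
    (D : Set (ℝ × ℝ)) (hD : MeasurableSet D) (hD0 : ∀ q ∈ D, 0 < q.1 ∧ 0 < q.2)
    (f : ℝ × ℝ → ℝ) (hf : Measurable f) (hf0 : ∀ q, 0 ≤ f q) (K : ENNReal)
    (hK : ∫⁻ x : Euc (m+n), D.indicator (fun q => ENNReal.ofReal (f q)) (sVar m x, tVar m x) ≤ K) :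
    ∫⁻ q in D, ENNReal.ofReal (f q * (|q.1| ^ (m-1) * |q.2| ^ (n-1))) ≤ c⁻¹ * K := by
  rw [hc _ (Measurable.indicator (by fun_prop) hD)] at hK
  rw [mul_comm, ← div_eq_mul_inv, ENNReal.le_div_iff_mul_le (Or.inl hc0) (Or.inl hct), mul_comm]
  refine le_trans (le_of_eq ?_) hK
  congr 1
  rw [← lintegral_indicator hD, ← lintegral_indicator (measurableSet_Ioi.prod measurableSet_Ioi)]
  refine lintegral_congr fun q => ?_
  by_cases hq : q ∈ D
  · obtain ⟨h1, h2⟩ := hD0 q hq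
    rw [indicator_of_mem hq, indicator_of_mem (by exact ⟨h1, h2⟩), indicator_of_mem hq,
      ENNReal.ofReal_mul (hf0 q), abs_of_pos h1, abs_of_pos h2]
  · rw [indicator_of_notMem hq]
    by_cases h : q ∈ (Ioi (0:ℝ)) ×ˢ (Ioi (0:ℝ))
    · rw [indicator_of_mem h, indicator_of_notMem hq, zero_mul]
    · rw [indicator_of_notMem h]

lemma main_aux (m n : ℕ) (hm : 1 ≤ m) (hn : 1 ≤ n)
    (Ω : Set (Euc (m+n))) (hΩopen : IsOpen Ω) (hΩbdd : Bornology.IsBounded Ω)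
    (hΩsym : ∀ x y : Euc (m+n), sVar m x = sVar m y → tVar m x = tVar m y →
      (x ∈ Ω ↔ y ∈ Ω)) :
    ∀ k : ℕ, ∃ C : ENNReal, C ≠ ⊤ ∧
      ∀ (φ : Euc (m+n) → ℝ) (w : ℝ → ℝ → ℝ),
        MemH10 Ω φ → (∀ x, 0 ≤ φ x) →
        (∀ x, φ x = w (sVar m x) (tVar m x)) →
        (∫⁻ x in Ω, ENNReal.ofReal (‖fderiv ℝ φ x‖ ^ 2)) ≤ 1 →
        ∫⁻ q in crossSection m Ω, ENNReal.ofReal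
          (φ (PP m n hm hn q) ^ (2 * ((m+n : ℕ) : ℝ) / (((m+n : ℕ) : ℝ) - 2) + 2 * (k : ℝ)) *
            (|q.1| ^ (m-1) * |q.2| ^ (n-1)) ^ ((k : ℝ) + 1)) ≤ C := by
  obtain ⟨c, hc0, hct, hc⟩ := polar m n hm hn
  set D := crossSection m Ω with hDdef
  have hDo : IsOpen D := cross_open m n hm hn Ω hΩopen hΩsym
  have hDb : Bornology.IsBounded D := cross_bdd m n hm hn Ω hΩbdd hΩsym
  have hD0 : ∀ q ∈ D, 0 < q.1 ∧ 0 < q.2 := fun q hq => ⟨hq.1, hq.2.1⟩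
  have hDi := cross_iff m n hm hn Ω hΩsym
  have hcinv : c⁻¹ ≠ ⊤ := ENNReal.inv_ne_top.2 hc0
  set r : ℝ := 2 * ((m+n : ℕ) : ℝ) / (((m+n : ℕ) : ℝ) - 2) with hr
  have hmn2 : (2:ℝ) ≤ ((m+n : ℕ) : ℝ) := by exact_mod_cast (by omega : 2 ≤ m + n)
  have hr0 : 0 ≤ r := div_nonneg (by linarith) (by linarith)
  have hWφ : ∀ (φ : Euc (m+n) → ℝ) (w : ℝ → ℝ → ℝ), (∀ x, φ x = w (sVar m x) (tVar m x)) →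
      ∀ x q, sVar m x = |q.1| → tVar m x = |q.2| → φ (PP m n hm hn q) = φ x := by
    intro φ w hw x q h1 h2
    rw [hw x, hw, sVar_PP, tVar_PP, h1, h2]
  intro k
  induction k with
  | zero =>
    by_cases h3 : 3 ≤ m + n
    · obtain ⟨K, hKt, hK⟩ := sobolev (m+n) h3
      refine ⟨c⁻¹ * K, ENNReal.mul_ne_top hcinv hKt, fun φ w hφ hnn hw hE => ?_⟩
      obtain ⟨hφc, hφd, hφz, -, -⟩ := hφ
      have hS := hK Ω φ hΩopen hΩbdd hφc hφd hφz hnn hE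
      have hPm := PP_cont m n hm hn
      have := polar_bound m n c hc0 hct hc D hDo.measurableSet hD0
        (fun q => φ (PP m n hm hn q) ^ r) ((hφc.comp hPm).measurable.pow_const r)
        (fun q => Real.rpow_nonneg (hnn _) _) K (by
          refine le_trans (lintegral_mono fun x => ?_) hS
          refine (indicator_le_self _ _ _).trans ?_
          rw [hWφ φ w hw x (sVar m x, tVar m x) (abs_of_nonneg (Real.sqrt_nonneg _)).symm
            (abs_of_nonneg (Real.sqrt_nonneg _)).symm])
      simpa using this
    · have hm1 : m = 1 := by omega
      have hn1 : n = 1 := by omega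
      have hr00 : r = 0 := by rw [hr, hm1, hn1]; norm_num
      refine ⟨volume D, hDb.measure_lt_top.ne, fun φ w hφ hnn hw hE => ?_⟩
      rw [hr00]
      simp [hm1, hn1]
  | succ k ih =>
    obtain ⟨C, hCt, hC⟩ := ih
    refine ⟨ENNReal.ofReal ((r / 2 + k + 1) ^ 2) * c⁻¹ * C,
      ENNReal.mul_ne_top (ENNReal.mul_ne_top ENNReal.ofReal_ne_top hcinv) hCt,
      fun φ w hφ hnn hw hE => ?_⟩
    have hk := hC φ w hφ hnn hw hE
    obtain ⟨hφc, hφd, hφz, -, -⟩ := hφ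
    set W : ℝ × ℝ → ℝ := fun q => φ (PP m n hm hn q) with hWdef
    have hWc : Continuous W := hφc.comp (PP_cont m n hm hn)
    have hG1 : Measurable (fun q : ℝ × ℝ => deriv (fun s => W (s, q.2)) q.1) :=
      (measurable_deriv_with_param (f := fun t s : ℝ => W (s, t)) (by
        simp only [Function.uncurry_def]; fun_prop)).comp measurable_swap
    have hG2 : Measurable (fun q : ℝ × ℝ => deriv (fun t => W (q.1, t)) q.2) :=
      measurable_deriv_with_param (f := fun s t : ℝ => W (s, t)) (by
        simp only [Function.uncurry_def]; fun_prop)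
    -- radial derivatives
    have hder1 : ∀ x ∈ Ω, 0 < sVar m x → ∃ L, |L| ≤ ‖fderiv ℝ φ x‖ ∧
        HasDerivAt (fun s => W (s, tVar m x)) L (sVar m x) := by
      intro x hx hs
      obtain ⟨v, hv1, hv⟩ := rad (fun j : Fin (m+n) => (j : ℕ) < m) (fun j => m ≤ (j : ℕ))
        (fun j h => by omega) x (sVar m x) rfl hs
      refine ⟨fderiv ℝ φ x v, ?_, ?_⟩
      · exact ((fderiv ℝ φ x).le_opNorm v).trans (mul_le_of_le_one_right (norm_nonneg _) hv1)
      · have hfun : (fun s => W (s, tVar m x)) = fun s => φ (x + (s - sVar m x) • v) := by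
          funext s
          refine hWφ φ w hw _ (s, tVar m x) (hv s).1 ?_
          rw [tVar, (hv s).2]
          exact (abs_of_nonneg (Real.sqrt_nonneg _)).symm
        rw [hfun]
        have hl : HasDerivAt (fun s : ℝ => x + (s - sVar m x) • v) v (sVar m x) := by
          simpa using (((hasDerivAt_id (sVar m x)).sub_const (sVar m x)).smul_const v).const_add x
        have hx' : x + (sVar m x - sVar m x) • v = x := by simp
        refine HasFDerivAt.comp_hasDerivAt (sVar m x) ?_ hl
        rw [hx']
        exact (hφd x hx).hasFDerivAt
    have hder2 : ∀ x ∈ Ω, 0 < tVar m x → ∃ L, |L| ≤ ‖fderiv ℝ φ x‖ ∧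
        HasDerivAt (fun t => W (sVar m x, t)) L (tVar m x) := by
      intro x hx hs
      obtain ⟨v, hv1, hv⟩ := rad (fun j : Fin (m+n) => m ≤ (j : ℕ)) (fun j => (j : ℕ) < m)
        (fun j h => by omega) x (tVar m x) rfl hs
      refine ⟨fderiv ℝ φ x v, ?_, ?_⟩
      · exact ((fderiv ℝ φ x).le_opNorm v).trans (mul_le_of_le_one_right (norm_nonneg _) hv1)
      · have hfun : (fun t => W (sVar m x, t)) = fun s => φ (x + (s - tVar m x) • v) := by
          funext s
          refine hWφ φ w hw _ (sVar m x, s) ?_ (hv s).1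
          rw [sVar, (hv s).2]
          exact (abs_of_nonneg (Real.sqrt_nonneg _)).symm
        rw [hfun]
        have hl : HasDerivAt (fun s : ℝ => x + (s - tVar m x) • v) v (tVar m x) := by
          simpa using (((hasDerivAt_id (tVar m x)).sub_const (tVar m x)).smul_const v).const_add x
        have hx' : x + (tVar m x - tVar m x) • v = x := by simp
        refine HasFDerivAt.comp_hasDerivAt (tVar m x) ?_ hl
        rw [hx']
        exact (hφd x hx).hasFDerivAt
    have hmemΩ : ∀ x, (sVar m x, tVar m x) ∈ D → x ∈ Ω := by
      rintro x ⟨-, -, y, hy, h1, h2⟩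
      exact (hΩsym y x h1 h2).1 hy
    have hE1 := polar_bound m n c hc0 hct hc D hDo.measurableSet hD0
      (fun q => |deriv (fun s => W (s, q.2)) q.1| ^ 2) (by fun_prop) (fun q => by positivity) 1 (by
        refine le_trans ?_ hE
        rw [← lintegral_indicator hΩopen.measurableSet]
        refine lintegral_mono fun x => ?_
        by_cases hx : (sVar m x, tVar m x) ∈ D
        · rw [indicator_of_mem hx, indicator_of_mem (hmemΩ x hx)]
          obtain ⟨L, hL, hL'⟩ := hder1 x (hmemΩ x hx) (hD0 _ hx).1
          simp only
          rw [hL'.deriv]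
          exact ENNReal.ofReal_le_ofReal (pow_le_pow_left₀ (abs_nonneg _) hL 2)
        · rw [indicator_of_notMem hx]; exact zero_le)
    have hE2 := polar_bound m n c hc0 hct hc D hDo.measurableSet hD0
      (fun q => |deriv (fun t => W (q.1, t)) q.2| ^ 2) (by fun_prop) (fun q => by positivity) 1 (by
        refine le_trans ?_ hE
        rw [← lintegral_indicator hΩopen.measurableSet]
        refine lintegral_mono fun x => ?_
        by_cases hx : (sVar m x, tVar m x) ∈ D
        · rw [indicator_of_mem hx, indicator_of_mem (hmemΩ x hx)]
          obtain ⟨L, hL, hL'⟩ := hder2 x (hmemΩ x hx) (hD0 _ hx).2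
          simp only
          rw [hL'.deriv]
          exact ENNReal.ofReal_le_ofReal (pow_le_pow_left₀ (abs_nonneg _) hL 2)
        · rw [indicator_of_notMem hx]; exact zero_le)
    rw [mul_one] at hE1 hE2
    have hk0 : (0:ℝ) ≤ k := Nat.cast_nonneg k
    have hst := step2d D hDo hDb hD0 W hWc (fun q => hnn _)
      (fun q h1 h2 hq => hφz _ fun h => hq ((hDi q).2 ⟨h1, h2, h⟩))
      (fun q => |q.1| ^ (m-1) * |q.2| ^ (n-1)) (by fun_prop) (fun q => by positivity)
      (fun s s' t hs hss ht => by
        simp only [abs_of_pos hs, abs_of_pos (hs.trans_le hss)]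
        gcongr)
      (fun s t t' hs htt ht => by
        simp only [abs_of_pos ht, abs_of_pos (ht.trans_le htt)]
        gcongr)
      (fun q hq => by
        obtain ⟨h1, h2, x, hx, hsx, htx⟩ := id hq
        obtain ⟨L, -, hL⟩ := hder1 x hx (by rw [hsx]; exact h1)
        rw [hsx, htx] at hL
        exact hL.differentiableAt)
      (fun q hq => by
        obtain ⟨h1, h2, x, hx, hsx, htx⟩ := id hq
        obtain ⟨L, -, hL⟩ := hder2 x hx (by rw [htx]; exact h2)
        rw [hsx, htx] at hL
        exact hL.differentiableAt)
      (r / 2 + k + 1) (k + 2) (by linarith) (by linarith) c⁻¹ hE1 hE2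
    have e1 : 2 * (r / 2 + k + 1) = r + 2 * ((k + 1 : ℕ) : ℝ) := by push_cast; ring
    have e2 : 2 * (r / 2 + k + 1) - 2 = r + 2 * (k : ℝ) := by ring
    have e3 : (k : ℝ) + 2 = ((k + 1 : ℕ) : ℝ) + 1 := by push_cast; ring
    have e4 : (k : ℝ) + 2 - 1 = k + 1 := by ring
    rw [e2, e4, e1, e3] at hst
    exact hst.trans (mul_le_mul_right hk _)

theorem statement10
    (m n N : ℕ) (hm : 1 ≤ m) (hn : 1 ≤ n) (hN : N = m + n)
    (Ω : Set (Euc N)) (hΩopen : IsOpen Ω) (hΩne : Ω.Nonempty)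
    (hΩbdd : Bornology.IsBounded Ω)
    -- `Ω` is a domain of double revolution
    (hΩsym : ∀ x y : Euc N, sVar m x = sVar m y → tVar m x = tVar m y →
      (x ∈ Ω ↔ y ∈ Ω)) :
    ∀ k : ℕ, ∃ C : ℝ, 0 ≤ C ∧
      ∀ (φ : Euc N → ℝ) (w : ℝ → ℝ → ℝ),
        MemH10 Ω φ → (∀ x, 0 ≤ φ x) →
        (∀ x, φ x = w (sVar m x) (tVar m x)) →
        (∫ x in Ω, ‖gradient φ x‖ ^ 2) = 1 →
        (∫ q in crossSection m Ω,
            w q.1 q.2 ^ (2 * (N : ℝ) / ((N : ℝ) - 2) + 2 * k) *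
              q.1 ^ ((k + 1) * (m - 1)) * q.2 ^ ((k + 1) * (n - 1))) ≤ C := by
  subst hN
  intro k
  obtain ⟨C, hCt, hC⟩ := main_aux m n hm hn Ω hΩopen hΩbdd hΩsym k
  refine ⟨C.toReal, ENNReal.toReal_nonneg, fun φ w hφ hnn hw hE => ?_⟩
  have hgrad : ∀ x, ‖gradient φ x‖ = ‖fderiv ℝ φ x‖ := fun x => by
    rw [gradient, LinearIsometryEquiv.norm_map]
  have hE' : (∫⁻ x in Ω, ENNReal.ofReal (‖fderiv ℝ φ x‖ ^ 2)) ≤ 1 := by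
    simp only [← hgrad]
    rw [← ofReal_integral_eq_lintegral_ofReal hφ.2.2.2.1
      (Eventually.of_forall fun x => by positivity), hE]
    simp
  have hJ := hC φ w hφ hnn hw hE'
  have hDm := (cross_open m n hm hn Ω hΩopen hΩsym).measurableSet
  have hφP : Measurable fun q => φ (PP m n hm hn q) := (hφ.1.comp (PP_cont m n hm hn)).measurable
  rw [setIntegral_congr_fun (g := fun q => (φ (PP m n hm hn q) ^ (2 * ((m+n : ℕ) : ℝ) / (((m+n : ℕ) : ℝ) - 2) + 2 * (k : ℝ)) *
            (|q.1| ^ (m-1) * |q.2| ^ (n-1)) ^ ((k : ℝ) + 1))) hDm]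
  · rw [integral_eq_lintegral_of_nonneg_ae]
    · exact ENNReal.toReal_mono hCt hJ
    · refine Eventually.of_forall fun q => ?_
      exact mul_nonneg (Real.rpow_nonneg (hnn _) _) (Real.rpow_nonneg (by positivity) _)
    · refine Measurable.aestronglyMeasurable ((hφP.pow_const _).mul (Measurable.pow_const ?_ _))
      fun_prop
  · intro q hq
    have h1 : 0 < q.1 := hq.1
    have h2 : 0 < q.2 := hq.2.1
    have e : (k : ℝ) + 1 = ((k + 1 : ℕ) : ℝ) := by push_cast; ring
    simp only
    rw [hw (PP m n hm hn q), sVar_PP, tVar_PP, abs_of_pos h1, abs_of_pos h2, e, Real.rpow_natCast,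
      mul_pow, ← pow_mul, ← pow_mul, mul_assoc, mul_comm (k+1) (m-1), mul_comm (k+1) (n-1)]

end
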